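/- arXiv:1008.2138 — 2 statements merged into one kernel-verified Lean document; each statement's English description precedes it below -/
import Mathlib

section
/- (Modeling error of BQNL.) Let η : ℤ → [0,1] be N-periodic with associated β_ξ := η_ξ, let y ∈ 𝒴 with min_ξ y'_ξ > 0, and set C̄_i := C_i(2 min_ξ y'_ξ). Then for every p ∈ [1,∞], ‖δΦ(y) − δΦ^bqnl_η(y)‖_{𝒰^{−1,p}} ≤ ε C̄₂ ‖(Δβ_ξ · y''_ξ)_ξ‖_{ℓ^p_ε} + ε² ( C̄₂ ‖((1−β_{ξ−1}) y'''_ξ)_ξ‖_{ℓ^p_ε} + C̄₃ ‖((1−β_ξ)(y''_ξ)²)_ξ‖_{ℓ^p_ε} ). -/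
open scoped BigOperators ENNReal
open Finset

noncomputable section

/-- The lattice spacing `ε = 1/N`. -/
def eps (N : ℕ) : ℝ := (N : ℝ)⁻¹

/-- `u : ℤ → ℝ` is `N`-periodic. -/
def IsPeriodic (N : ℕ) (u : ℤ → ℝ) : Prop := ∀ ξ : ℤ, u (ξ + N) = u ξ

/-- Membership in the space `𝒰` of `N`-periodic mean-zero displacements. -/
def inU (N : ℕ) (u : ℤ → ℝ) : Prop :=
  IsPeriodic N u ∧ ∑ ξ ∈ Finset.Icc (1 : ℤ) (N : ℤ), u ξ = 0

/-- The uniform deformation `y^F_ξ = F ε ξ`. -/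
def yUnif (N : ℕ) (F : ℝ) : ℤ → ℝ := fun ξ => F * eps N * ξ

/-- Membership in the space `𝒴` of admissible deformations. -/
def inY (N : ℕ) (y : ℤ → ℝ) : Prop :=
  ∃ F : ℝ, 0 < F ∧ ∃ u : ℤ → ℝ, inU N u ∧ y = fun ξ => yUnif N F ξ + u ξ

/-- The discrete first derivative `y'_ξ = (y_ξ - y_{ξ-1})/ε`. -/
def d1 (N : ℕ) (y : ℤ → ℝ) (ξ : ℤ) : ℝ := (y ξ - y (ξ - 1)) / eps N

/-- The discrete second derivative `y''_ξ`. -/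
def d2 (N : ℕ) (y : ℤ → ℝ) (ξ : ℤ) : ℝ :=
  (y (ξ + 1) - 2 * y ξ + y (ξ - 1)) / (eps N) ^ 2

/-- The discrete third derivative `y'''_ξ`. -/
def d3 (N : ℕ) (y : ℤ → ℝ) (ξ : ℤ) : ℝ :=
  (y (ξ + 1) - 3 * y ξ + 3 * y (ξ - 1) - y (ξ - 2)) / (eps N) ^ 3

/-- The BQC energy `Φ_{α,β}`. -/
def PhiBQC (N : ℕ) (φ : ℝ → ℝ) (α β : ℤ → ℝ) (y : ℤ → ℝ) : ℝ :=
  eps N * ∑ ξ ∈ Finset.Icc (1 : ℤ) (N : ℤ),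
    (φ (d1 N y ξ) + α ξ * φ (2 * d1 N y ξ) + β ξ * φ (d1 N y ξ + d1 N y (ξ + 1)))

/-- The BQNL energy with blending function `η`. -/
def PhiBQNL (N : ℕ) (φ : ℝ → ℝ) (η : ℤ → ℝ) : (ℤ → ℝ) → ℝ :=
  PhiBQC N φ (fun ξ => 1 - (η ξ + η (ξ - 1)) / 2) η

/-- The BQCE energy with blending function `γ`. -/
def PhiBQCE (N : ℕ) (φ : ℝ → ℝ) (γ : ℤ → ℝ) : (ℤ → ℝ) → ℝ :=
  PhiBQC N φ (fun ξ => (γ ξ + γ (ξ - 1)) / 2) (fun ξ => 1 - (γ (ξ + 1) + γ (ξ - 1)) / 2)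

/-- The atomistic energy `Φ`. -/
def PhiAt (N : ℕ) (φ : ℝ → ℝ) (y : ℤ → ℝ) : ℝ :=
  eps N * ∑ ξ ∈ Finset.Icc (1 : ℤ) (N : ℤ),
    (φ (d1 N y ξ) + φ (d1 N y ξ + d1 N y (ξ + 1)))

/-- The first variation `δΨ(y)[u] = (d/dt)|_{t=0} Ψ(y+tu)`. -/
def fvar (Ψ : (ℤ → ℝ) → ℝ) (y u : ℤ → ℝ) : ℝ :=
  deriv (fun t : ℝ => Ψ (fun ξ => y ξ + t * u ξ)) 0

/-- The second variation `δ²Ψ(y)[u,u] = (d²/dt²)|_{t=0} Ψ(y+tu)`. -/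
def svar (Ψ : (ℤ → ℝ) → ℝ) (y u : ℤ → ℝ) : ℝ :=
  iteratedDeriv 2 (fun t : ℝ => Ψ (fun ξ => y ξ + t * u ξ)) 0

/-- `max_ξ |v_ξ|` (for a periodic sequence this is a genuine maximum). -/
def supAbs (v : ℤ → ℝ) : ℝ := sSup (Set.range fun ξ => |v ξ|)

/-- `min_ξ y'_ξ` (for an admissible deformation this is a genuine minimum). -/
def infD1 (N : ℕ) (y : ℤ → ℝ) : ℝ := sInf (Set.range fun ξ => d1 N y ξ)

/-- The constant `C_i(r₀) = sup_{r ≥ r₀} |φ^(i)(r)|`. -/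
def Cbound (φ : ℝ → ℝ) (i : ℕ) (r₀ : ℝ) : ℝ :=
  sSup ((fun r => |iteratedDeriv i φ r|) '' Set.Ici r₀)

/-- The `ℓ^p_ε` norm over one period, `p ∈ [1,∞]`. -/
def lpnorm (N : ℕ) (p : ℝ≥0∞) (v : ℤ → ℝ) : ℝ :=
  if p = ⊤ then supAbs v
  else (eps N * ∑ ξ ∈ Finset.Icc (1 : ℤ) (N : ℤ), |v ξ| ^ p.toReal) ^ (1 / p.toReal)

/-- The Hessian coefficient `A_ξ` of the atomistic energy. -/
def Acoef (N : ℕ) (φ : ℝ → ℝ) (y : ℤ → ℝ) (ξ : ℤ) : ℝ :=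
  iteratedDeriv 2 φ (d1 N y ξ) + 2 * iteratedDeriv 2 φ (d1 N y ξ + d1 N y (ξ + 1))
    + 2 * iteratedDeriv 2 φ (d1 N y (ξ - 1) + d1 N y ξ)

/-- The Hessian coefficient `Ā_ξ` of the BQC energy. -/
def AbarCoef (N : ℕ) (φ : ℝ → ℝ) (α β : ℤ → ℝ) (y : ℤ → ℝ) (ξ : ℤ) : ℝ :=
  iteratedDeriv 2 φ (d1 N y ξ) + 2 * β ξ * iteratedDeriv 2 φ (d1 N y ξ + d1 N y (ξ + 1))
    + 2 * β (ξ - 1) * iteratedDeriv 2 φ (d1 N y (ξ - 1) + d1 N y ξ)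
    + 4 * α ξ * iteratedDeriv 2 φ (2 * d1 N y ξ)

/-- The coercivity constant `inf { δ²Ψ(y)[u,u] : u ∈ 𝒰, ‖u'‖_{ℓ²_ε} = 1 }`. -/
def coercConst (N : ℕ) (Ψ : (ℤ → ℝ) → ℝ) (y : ℤ → ℝ) : ℝ :=
  sInf { c : ℝ | ∃ u : ℤ → ℝ, inU N u ∧ lpnorm N 2 (d1 N u) = 1 ∧ c = svar Ψ y u }

end

theorem IsPeriodic.apply_add_sub_one {N : ℕ} {f : ℤ → ℝ} (hf : IsPeriodic N f) (ξ : ℤ) :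
    f (ξ + N - 1) = f (ξ - 1) := by
  rw [add_sub_right_comm, hf]

theorem IsPeriodic.apply_add_add_one {N : ℕ} {f : ℤ → ℝ} (hf : IsPeriodic N f) (ξ : ℤ) :
    f (ξ + N + 1) = f (ξ + 1) := by
  rw [add_right_comm, hf]

theorem IsPeriodic.comp_sub_one {N : ℕ} {f : ℤ → ℝ} (hf : IsPeriodic N f) :
    IsPeriodic N fun ξ => f (ξ - 1) :=
  hf.apply_add_sub_one

theorem IsPeriodic.d1 {N : ℕ} {u : ℤ → ℝ} (hu : IsPeriodic N u) : IsPeriodic N (d1 N u) :=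
  fun ξ => by rw [_root_.d1, _root_.d1, hu ξ, hu.apply_add_sub_one ξ]

theorem eps_pos {N : ℕ} (hN : 0 < N) : 0 < eps N := by
  unfold eps
  positivity

theorem inY.isPeriodic_d1 {N : ℕ} {y : ℤ → ℝ} (hy : inY N y) : IsPeriodic N (d1 N y) := by
  obtain ⟨F, -, u, ⟨hu, -⟩, rfl⟩ := hy
  intro ξ
  simp only [d1, yUnif, hu ξ, hu.apply_add_sub_one ξ]
  push_cast
  ring

theorem d2_eq {N : ℕ} (hN : 0 < N) (y : ℤ → ℝ) (ξ : ℤ) :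
    d2 N y ξ = (d1 N y (ξ + 1) - d1 N y ξ) / eps N := by
  have := (eps_pos hN).ne'
  simp only [d2, d1, add_sub_cancel_right]
  field_simp
  ring

theorem d3_eq {N : ℕ} (hN : 0 < N) (y : ℤ → ℝ) (ξ : ℤ) :
    d3 N y ξ = (d1 N y (ξ + 1) - 2 * d1 N y ξ + d1 N y (ξ - 1)) / eps N ^ 2 := by
  have := (eps_pos hN).ne'
  simp only [d3, d1, add_sub_cancel_right, show ξ - 1 - 1 = ξ - 2 by ring]
  field_simp
  ring

theorem infD1_le {N : ℕ} {y : ℤ → ℝ} (hy : 0 < infD1 N y) (ξ : ℤ) : infD1 N y ≤ d1 N y ξ := by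
  refine csInf_le ?_ ⟨ξ, rfl⟩
  by_contra h
  exact hy.ne' (Real.sInf_of_not_bddBelow h)

/-- The sum of a periodic sequence over one period is shift invariant. -/
theorem IsPeriodic.sum_comp_sub_one {N : ℕ} {f : ℤ → ℝ} (hf : IsPeriodic N f) :
    ∑ ξ ∈ Finset.Icc (1 : ℤ) N, f (ξ - 1) = ∑ ξ ∈ Finset.Icc (1 : ℤ) N, f ξ := by
  have telescope (n : ℕ) : ∑ ξ ∈ Finset.Icc (1 : ℤ) n, (f ξ - f (ξ - 1)) = f n - f 0 := by
    induction n with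
    | zero => simp
    | succ n ih =>
      have hIcc : Finset.Icc (1 : ℤ) ((n + 1 : ℕ) : ℤ)
          = insert ((n : ℤ) + 1) (Finset.Icc (1 : ℤ) n) := by
        ext x
        simp only [Finset.mem_Icc, Finset.mem_insert]
        omega
      rw [hIcc, Finset.sum_insert (by simp), ih]
      push_cast
      rw [add_sub_cancel_right]
      ring
  have h := telescope N
  have hN := hf 0
  rw [zero_add] at hN
  rw [hN, sub_self, Finset.sum_sub_distrib] at h
  linarith

theorem IsPeriodic.bddAbove_abs {N : ℕ} (hN : 0 < N) {f : ℤ → ℝ} (hf : IsPeriodic N f) :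
    BddAbove (Set.range fun ξ => |f ξ|) := by
  have hper : Function.Periodic (fun ξ => |f ξ|) (N : ℤ) := fun ξ => by simp only [hf ξ]
  rw [← hper.image_Ioc (by exact_mod_cast hN) 0]
  exact ((Set.finite_Ioc _ _).image _).bddAbove

theorem IsPeriodic.abs_le_supAbs {N : ℕ} (hN : 0 < N) {f : ℤ → ℝ} (hf : IsPeriodic N f) (ξ : ℤ) :
    |f ξ| ≤ supAbs f :=
  le_csSup (hf.bddAbove_abs hN) ⟨ξ, rfl⟩

theorem lpnorm_nonneg (N : ℕ) (p : ℝ≥0∞) (f : ℤ → ℝ) : 0 ≤ lpnorm N p f := by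
  unfold lpnorm
  split_ifs
  · refine Real.sSup_nonneg ?_
    rintro _ ⟨ξ, rfl⟩
    exact abs_nonneg _
  · unfold eps
    positivity

theorem lpnorm_one (N : ℕ) (f : ℤ → ℝ) :
    lpnorm N 1 f = eps N * ∑ ξ ∈ Finset.Icc (1 : ℤ) N, |f ξ| := by
  simp [lpnorm]

theorem lpnorm_top (N : ℕ) (f : ℤ → ℝ) : lpnorm N ⊤ f = supAbs f := by
  simp [lpnorm]

theorem IsPeriodic.lpnorm_comp_sub_one {N : ℕ} {f : ℤ → ℝ} (hf : IsPeriodic N f) (p : ℝ≥0∞) :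
    lpnorm N p (fun ξ => f (ξ - 1)) = lpnorm N p f := by
  unfold lpnorm
  split_ifs
  · unfold supAbs
    congr 1
    exact (Equiv.subRight (1 : ℤ)).surjective.range_comp fun ξ => |f ξ|
  · have hper : IsPeriodic N fun ξ => |f ξ| ^ p.toReal := fun ξ => by simp only [hf ξ]
    rw [hper.sum_comp_sub_one]

/-- Hölder's inequality with one factor in `ℓ^∞` and the other in `ℓ^1_ε`. -/
theorem sum_abs_mul_le_supAbs_mul {N : ℕ} (hN : 0 < N) {f : ℤ → ℝ} (hf : IsPeriodic N f)
    (g : ℤ → ℝ) :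
    eps N * ∑ ξ ∈ Finset.Icc (1 : ℤ) N, |f ξ| * |g ξ| ≤ lpnorm N ⊤ f * lpnorm N 1 g := by
  rw [lpnorm_one, lpnorm_top, mul_left_comm, Finset.mul_sum _ _ (supAbs f)]
  have := eps_pos hN
  gcongr with ξ
  exact hf.abs_le_supAbs hN ξ

/-- Hölder's inequality for periodic sequences. -/
theorem sum_abs_mul_le_lpnorm_mul {N : ℕ} (hN : 0 < N) {f g : ℤ → ℝ} (hf : IsPeriodic N f)
    (hg : IsPeriodic N g) {p q : ℝ≥0∞} (hpq : 1 / p + 1 / q = 1) :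
    eps N * ∑ ξ ∈ Finset.Icc (1 : ℤ) N, |f ξ| * |g ξ| ≤ lpnorm N p f * lpnorm N q g := by
  rw [one_div, one_div] at hpq
  by_cases hp : p = ⊤
  · subst hp
    obtain rfl : q = 1 := by simpa using hpq
    exact sum_abs_mul_le_supAbs_mul hN hf g
  by_cases hq : q = ⊤
  · subst hq
    obtain rfl : p = 1 := by simpa using hpq
    rw [mul_comm (lpnorm N 1 f)]
    simpa only [mul_comm] using sum_abs_mul_le_supAbs_mul hN hg f
  have hp0 : p ≠ 0 := by rintro rfl; simp at hpq
  have hq0 : q ≠ 0 := by rintro rfl; simp at hpq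
  have hsum : p.toReal⁻¹ + q.toReal⁻¹ = 1 := by
    rw [← ENNReal.toReal_inv, ← ENNReal.toReal_inv,
      ← ENNReal.toReal_add (ENNReal.inv_ne_top.2 hp0) (ENNReal.inv_ne_top.2 hq0), hpq,
      ENNReal.toReal_one]
  have hconj : p.toReal.HolderConjugate q.toReal :=
    ⟨by simpa using hsum, ENNReal.toReal_pos hp0 hp, ENNReal.toReal_pos hq0 hq⟩
  have hε := eps_pos hN
  have hsplit : eps N = eps N ^ (1 / p.toReal) * eps N ^ (1 / q.toReal) := by
    rw [← Real.rpow_add hε, one_div, one_div, hsum, Real.rpow_one]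
  have hH :=
    Real.inner_le_Lp_mul_Lq (Finset.Icc (1 : ℤ) N) (fun ξ => |f ξ|) (fun ξ => |g ξ|) hconj
  simp only [abs_abs] at hH
  simp only [lpnorm, if_neg hp, if_neg hq]
  rw [Real.mul_rpow hε.le (by positivity), Real.mul_rpow hε.le (by positivity), mul_mul_mul_comm,
    ← hsplit]
  exact mul_le_mul_of_nonneg_left hH hε.le

theorem hasDerivAt_iteratedDeriv {φ : ℝ → ℝ} {n : ℕ} (hφ : ContDiffOn ℝ n φ (Set.Ioi 0))
    {i : ℕ} (hi : i < n) {r : ℝ} (hr : 0 < r) :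
    HasDerivAt (iteratedDeriv i φ) (iteratedDeriv (i + 1) φ r) r := by
  have hdiff := hφ.differentiableOn_iteratedDerivWithin (m := i) (by exact_mod_cast hi)
    (uniqueDiffOn_Ioi 0)
  have h := (hdiff.congr fun x hx => (iteratedDerivWithin_of_isOpen isOpen_Ioi hx).symm)
    |>.differentiableAt (Ioi_mem_nhds hr)
  rw [iteratedDeriv_succ]
  exact h.hasDerivAt

theorem abs_iteratedDeriv_le_Cbound {φ : ℝ → ℝ} {i : ℕ} {r₀ : ℝ}
    (hC : BddAbove ((fun r => |iteratedDeriv i φ r|) '' Set.Ici r₀)) {r : ℝ} (hr : r₀ ≤ r) :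
    |iteratedDeriv i φ r| ≤ Cbound φ i r₀ :=
  le_csSup hC ⟨r, hr, rfl⟩

/-- First-order Taylor estimate on a half line, valid in both directions. -/
theorem abs_sub_sub_le_of_abs_deriv2_le {g g' g'' : ℝ → ℝ} {r₀ C : ℝ}
    (hg : ∀ r, r₀ ≤ r → HasDerivAt g (g' r) r) (hg' : ∀ r, r₀ ≤ r → HasDerivAt g' (g'' r) r)
    (hC : ∀ r, r₀ ≤ r → |g'' r| ≤ C) {x z : ℝ} (hx : r₀ ≤ x) (hz : r₀ ≤ z) :
    |g z - g x - g' x * (z - x)| ≤ C / 2 * (z - x) ^ 2 := by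
  have hmem : ∀ t ∈ Set.Icc (0 : ℝ) 1, r₀ ≤ x + t * (z - x) := fun t ht => by
    nlinarith [mul_nonneg ht.1 (sub_nonneg.2 hz), mul_nonneg (sub_nonneg.2 ht.2) (sub_nonneg.2 hx)]
  have hline (t : ℝ) : HasDerivAt (fun t => x + t * (z - x)) (z - x) t := by
    simpa using ((hasDerivAt_id t).mul_const (z - x)).const_add x
  have hf : ∀ t ∈ Set.Icc (0 : ℝ) 1,
      HasDerivAt (fun t => g (x + t * (z - x)) - g x - g' x * (z - x) * t)
        ((g' (x + t * (z - x)) - g' x) * (z - x)) t := fun t ht => by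
    have h := (((hg _ (hmem t ht)).comp t (hline t)).sub_const (g x)).sub
      ((hasDerivAt_id t).const_mul (g' x * (z - x)))
    refine h.congr_deriv ?_
    ring
  have hB (t : ℝ) : HasDerivAt (fun t => C / 2 * (z - x) ^ 2 * t ^ 2) (C * (z - x) ^ 2 * t) t := by
    refine ((hasDerivAt_pow 2 t).const_mul (C / 2 * (z - x) ^ 2)).congr_deriv ?_
    push_cast
    ring
  have h := image_norm_le_of_norm_deriv_right_le_deriv_boundary (a := 0) (b := 1)
    (fun t ht => (hf t ht).continuousAt.continuousWithinAt)
    (fun t ht => (hf t (Set.Ico_subset_Icc_self ht)).hasDerivWithinAt) (by simp) hB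
    (fun t ht => by
      have hlip := (convex_Ici r₀).norm_image_sub_le_of_norm_hasDerivWithin_le
        (fun r hr => (hg' r hr).hasDerivWithinAt) hC hx (hmem t (Set.Ico_subset_Icc_self ht))
      rw [norm_mul]
      calc _ ≤ C * ‖x + t * (z - x) - x‖ * ‖z - x‖ := by gcongr
        _ = C * (z - x) ^ 2 * t := by
          rw [add_sub_cancel_left, norm_mul, Real.norm_of_nonneg ht.1, Real.norm_eq_abs,
            ← sq_abs (z - x)]
          ring)
    (Set.right_mem_Icc.2 zero_le_one)
  simpa using h

theorem d1_add_mul (N : ℕ) (y u : ℤ → ℝ) (t : ℝ) (ξ : ℤ) :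
    d1 N (fun ξ => y ξ + t * u ξ) ξ = d1 N y ξ + t * d1 N u ξ := by
  simp only [d1]
  ring

theorem hasDerivAt_comp_line {φ : ℝ → ℝ} {a v : ℝ} (hφ : DifferentiableAt ℝ φ a) :
    HasDerivAt (fun t : ℝ => φ (a + t * v)) (deriv φ a * v) 0 := by
  have hline : HasDerivAt (fun t : ℝ => a + t * v) v 0 := by
    simpa using ((hasDerivAt_id (0 : ℝ)).mul_const v).const_add a
  exact HasDerivAt.comp (h₂ := φ) 0 (by simpa using hφ.hasDerivAt) hline

theorem fvar_PhiBQC {N : ℕ} {φ : ℝ → ℝ} (hφ : ∀ r, 0 < r → DifferentiableAt ℝ φ r)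
    (α β : ℤ → ℝ) {y : ℤ → ℝ} (hy : ∀ ξ, 0 < d1 N y ξ) (u : ℤ → ℝ) :
    fvar (PhiBQC N φ α β) y u = eps N * ∑ ξ ∈ Finset.Icc (1 : ℤ) N,
      (deriv φ (d1 N y ξ) * d1 N u ξ + α ξ * (deriv φ (2 * d1 N y ξ) * (2 * d1 N u ξ))
        + β ξ * (deriv φ (d1 N y ξ + d1 N y (ξ + 1)) * (d1 N u ξ + d1 N u (ξ + 1)))) := by
  refine HasDerivAt.deriv ?_
  simp only [PhiBQC, d1_add_mul]
  refine (HasDerivAt.fun_sum fun ξ _ => ?_).const_mul _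
  have h₁ := hasDerivAt_comp_line (v := d1 N u ξ) (hφ _ (hy ξ))
  have h₂ := hasDerivAt_comp_line (v := 2 * d1 N u ξ) (hφ _ (mul_pos two_pos (hy ξ)))
  have h₃ := hasDerivAt_comp_line (v := d1 N u ξ + d1 N u (ξ + 1))
    (hφ _ (add_pos (hy ξ) (hy (ξ + 1))))
  refine ((h₁.add (h₂.const_mul (α ξ))).add (h₃.const_mul (β ξ))).congr_of_eventuallyEq ?_
  refine Filter.Eventually.of_forall fun t => ?_
  simp only [Pi.add_apply]
  ring_nf

theorem PhiAt_eq_PhiBQC (N : ℕ) (φ : ℝ → ℝ) : PhiAt N φ = PhiBQC N φ (fun _ => 0) fun _ => 1 := by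
  ext y
  simp [PhiAt, PhiBQC]

/-- Stress representation of the difference between the atomistic and the BQNL first variations. -/
theorem fvar_PhiAt_sub_fvar_PhiBQNL {N : ℕ} {φ : ℝ → ℝ}
    (hφ : ∀ r, 0 < r → DifferentiableAt ℝ φ r) {η : ℤ → ℝ} (hη : IsPeriodic N η) {y : ℤ → ℝ}
    (hyper : IsPeriodic N (d1 N y)) (hy : ∀ ξ, 0 < d1 N y ξ) {u : ℤ → ℝ}
    (hu : IsPeriodic N (d1 N u)) :
    fvar (PhiAt N φ) y u - fvar (PhiBQNL N φ η) y u = eps N * ∑ ξ ∈ Finset.Icc (1 : ℤ) N,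
      ((1 - η ξ) * (deriv φ (d1 N y ξ + d1 N y (ξ + 1)) - deriv φ (2 * d1 N y ξ))
        + (1 - η (ξ - 1)) * (deriv φ (d1 N y (ξ - 1) + d1 N y ξ) - deriv φ (2 * d1 N y ξ)))
        * d1 N u ξ := by
  have hper : IsPeriodic N fun ξ =>
      (1 - η ξ) * deriv φ (d1 N y ξ + d1 N y (ξ + 1)) * d1 N u (ξ + 1) := fun ξ => by
    simp only [hη ξ, hyper ξ, hyper.apply_add_add_one ξ, hu.apply_add_add_one ξ]
  have hshift := hper.sum_comp_sub_one
  simp only [sub_add_cancel] at hshift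
  rw [PhiAt_eq_PhiBQC, PhiBQNL, fvar_PhiBQC hφ _ _ hy, fvar_PhiBQC hφ _ _ hy, ← mul_sub,
    ← Finset.sum_sub_distrib]
  congr 1
  rw [← sub_eq_zero, ← Finset.sum_sub_distrib] at hshift ⊢
  refine Eq.trans ?_ (neg_eq_zero.2 hshift)
  rw [← Finset.sum_neg_distrib]
  refine Finset.sum_congr rfl fun ξ _ => ?_
  ring

/-- Bound for the stress error at a single bond with strain `a` and neighbouring strains `c`, `b`;
`s` and `t` are the local weights of the Cauchy-Born approximation. -/
theorem abs_stress_error_le {g g' g'' : ℝ → ℝ} {m C₂ C₃ : ℝ}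
    (hg : ∀ r, 2 * m ≤ r → HasDerivAt g (g' r) r) (hg' : ∀ r, 2 * m ≤ r → HasDerivAt g' (g'' r) r)
    (hC₂ : ∀ r, 2 * m ≤ r → |g' r| ≤ C₂) (hC₃ : ∀ r, 2 * m ≤ r → |g'' r| ≤ C₃)
    {a b c s t : ℝ} (ha : m ≤ a) (hb : m ≤ b) (hc : m ≤ c) (hs : 0 ≤ s) (ht : 0 ≤ t) :
    |s * (g (a + b) - g (2 * a)) + t * (g (c + a) - g (2 * a))| ≤
      C₂ * |(s - t) * (b - a)| + C₂ * |t * (b - 2 * a + c)|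
        + C₃ / 2 * (s * (b - a) ^ 2) + C₃ / 2 * (t * (a - c) ^ 2) := by
  have h₁ := abs_sub_sub_le_of_abs_deriv2_le hg hg' hC₃ (x := 2 * a) (z := a + b)
    (by linarith) (by linarith)
  have h₂ := abs_sub_sub_le_of_abs_deriv2_le hg hg' hC₃ (x := 2 * a) (z := c + a)
    (by linarith) (by linarith)
  have h₃ := hC₂ (2 * a) (by linarith)
  set r₁ := g (a + b) - g (2 * a) - g' (2 * a) * (a + b - 2 * a) with hr₁
  set r₂ := g (c + a) - g (2 * a) - g' (2 * a) * (c + a - 2 * a) with hr₂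
  have hsplit : s * (g (a + b) - g (2 * a)) + t * (g (c + a) - g (2 * a)) =
      g' (2 * a) * ((s - t) * (b - a)) + g' (2 * a) * (t * (b - 2 * a + c)) + s * r₁ + t * r₂ := by
    rw [hr₁, hr₂]
    ring
  rw [hsplit]
  calc _ ≤ |g' (2 * a) * ((s - t) * (b - a))| + |g' (2 * a) * (t * (b - 2 * a + c))|
          + |s * r₁| + |t * r₂| := by
        refine (abs_add_le _ _).trans (add_le_add_left ((abs_add_le _ _).trans
          (add_le_add_left (abs_add_le _ _) _)) _)
    _ ≤ C₂ * |(s - t) * (b - a)| + C₂ * |t * (b - 2 * a + c)|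
          + s * (C₃ / 2 * (a + b - 2 * a) ^ 2) + t * (C₃ / 2 * (c + a - 2 * a) ^ 2) := by
        rw [abs_mul (g' _), abs_mul (g' _), abs_mul s, abs_mul t r₂, abs_of_nonneg hs,
          abs_of_nonneg ht]
        gcongr
    _ = _ := by ring

/-- Modeling error of BQNL in the dual norm. -/
theorem modeling_error_bqnl
    (N : ℕ) (hN : 5 ≤ N) (φ : ℝ → ℝ) (hφ : ContDiffOn ℝ 4 φ (Set.Ioi 0))
    (hC : ∀ i ≤ 4, ∀ r₀ : ℝ, 0 < r₀ →
      BddAbove ((fun r => |iteratedDeriv i φ r|) '' Set.Ici r₀))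
    (η : ℤ → ℝ) (hηper : IsPeriodic N η) (hη01 : ∀ ξ, η ξ ∈ Set.Icc (0 : ℝ) 1)
    (β : ℤ → ℝ) (hβ : β = η)
    (y : ℤ → ℝ) (hy : inY N y) (hy' : 0 < infD1 N y)
    (p q : ℝ≥0∞) (hp : 1 ≤ p) (hq : 1 ≤ q) (hpq : 1 / p + 1 / q = 1)
    (u : ℤ → ℝ) (hu : inU N u) (hu1 : lpnorm N q (d1 N u) ≤ 1) :
    |fvar (PhiAt N φ) y u - fvar (PhiBQNL N φ η) y u| ≤
      eps N * Cbound φ 2 (2 * infD1 N y) *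
          lpnorm N p (fun ξ => (β ξ - β (ξ - 1)) * d2 N y ξ)
        + (eps N) ^ 2 *
            (Cbound φ 2 (2 * infD1 N y) * lpnorm N p (fun ξ => (1 - β (ξ - 1)) * d3 N y ξ)
              + Cbound φ 3 (2 * infD1 N y) *
                  lpnorm N p (fun ξ => (1 - β ξ) * (d2 N y ξ) ^ 2)) := by
  subst hβ
  have hN0 : 0 < N := by omega
  have hε := eps_pos hN0
  have hφ' {i : ℕ} (hi : i < 4) {r : ℝ} (hr : 0 < r) :
      HasDerivAt (iteratedDeriv i φ) (iteratedDeriv (i + 1) φ r) r :=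
    hasDerivAt_iteratedDeriv (n := 4) (by exact_mod_cast hφ) hi hr
  have hdiff (r : ℝ) (hr : 0 < r) : DifferentiableAt ℝ φ r := by
    simpa using (hφ' (i := 0) (by norm_num) hr).differentiableAt
  have ham := infD1_le hy'
  have haper := hy.isPeriodic_d1
  have hvper := hu.1.d1
  have haper' := haper.apply_add_add_one
  have haper'' := haper.apply_add_sub_one
  have hβper' := hηper.apply_add_sub_one
  set m := infD1 N y
  have hm (r : ℝ) (hr : 2 * m ≤ r) : 0 < r := by linarith
  have hC₂ (r : ℝ) (hr : 2 * m ≤ r) :=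
    abs_iteratedDeriv_le_Cbound (hC 2 (by norm_num) (2 * m) (by linarith)) hr
  have hC₃ (r : ℝ) (hr : 2 * m ≤ r) :=
    abs_iteratedDeriv_le_Cbound (hC 3 (by norm_num) (2 * m) (by linarith)) hr
  have hC₂0 := (abs_nonneg _).trans (hC₂ (2 * m) le_rfl)
  have hC₃0 := (abs_nonneg _).trans (hC₃ (2 * m) le_rfl)
  set C₂ := Cbound φ 2 (2 * m)
  set C₃ := Cbound φ 3 (2 * m)
  set f₁ : ℤ → ℝ := fun ξ => (β ξ - β (ξ - 1)) * d2 N y ξ with hf₁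
  set f₂ : ℤ → ℝ := fun ξ => (1 - β (ξ - 1)) * d3 N y ξ with hf₂
  set f₃ : ℤ → ℝ := fun ξ => (1 - β ξ) * d2 N y ξ ^ 2 with hf₃
  have hf₁per : IsPeriodic N f₁ := fun ξ => by
    simp only [hf₁, d2_eq hN0]
    rw [hηper ξ, hβper' ξ, haper' ξ, haper ξ]
  have hf₂per : IsPeriodic N f₂ := fun ξ => by
    simp only [hf₂, d3_eq hN0]
    rw [hβper' ξ, haper' ξ, haper ξ, haper'' ξ]
  have hf₃per : IsPeriodic N f₃ := fun ξ => by
    simp only [hf₃, d2_eq hN0]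
    rw [hηper ξ, haper' ξ, haper ξ]
  have holder {f : ℤ → ℝ} (hf : IsPeriodic N f) :
      eps N * ∑ ξ ∈ Finset.Icc (1 : ℤ) N, |f ξ| * |d1 N u ξ| ≤ lpnorm N p f :=
    (sum_abs_mul_le_lpnorm_mul hN0 hf hvper hpq).trans
      (mul_le_of_le_one_right (lpnorm_nonneg N p f) hu1)
  have h₃' := holder hf₃per.comp_sub_one
  rw [hf₃per.lpnorm_comp_sub_one] at h₃'
  have hstress (ξ : ℤ) :
      |(1 - β ξ) * (deriv φ (d1 N y ξ + d1 N y (ξ + 1)) - deriv φ (2 * d1 N y ξ))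
        + (1 - β (ξ - 1)) * (deriv φ (d1 N y (ξ - 1) + d1 N y ξ) - deriv φ (2 * d1 N y ξ))| ≤
      eps N * C₂ * |f₁ ξ| + eps N ^ 2 * C₂ * |f₂ ξ| + eps N ^ 2 * (C₃ / 2) * |f₃ ξ|
        + eps N ^ 2 * (C₃ / 2) * |f₃ (ξ - 1)| := by
    have hs := sub_nonneg.2 (hη01 ξ).2
    have ht := sub_nonneg.2 (hη01 (ξ - 1)).2
    have h := abs_stress_error_le (g := deriv φ) (g' := iteratedDeriv 2 φ)
      (g'' := iteratedDeriv 3 φ)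
      (fun r hr => by simpa using hφ' (i := 1) (by norm_num) (hm r hr))
      (fun r hr => hφ' (by norm_num) (hm r hr)) hC₂ hC₃ (ham ξ) (ham (ξ + 1)) (ham (ξ - 1)) hs ht
    refine h.trans_eq ?_
    have e₁ : (1 - β ξ - (1 - β (ξ - 1))) * (d1 N y (ξ + 1) - d1 N y ξ) = -(eps N * f₁ ξ) := by
      simp only [hf₁, d2_eq hN0]
      field_simp
      ring
    have e₂ : (1 - β (ξ - 1)) * (d1 N y (ξ + 1) - 2 * d1 N y ξ + d1 N y (ξ - 1))
        = eps N ^ 2 * f₂ ξ := by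
      simp only [hf₂, d3_eq hN0]
      field_simp
    have e₃ : (1 - β ξ) * (d1 N y (ξ + 1) - d1 N y ξ) ^ 2 = eps N ^ 2 * |f₃ ξ| := by
      rw [abs_of_nonneg (mul_nonneg hs (sq_nonneg _))]
      simp only [d2_eq hN0]
      field_simp
    have e₄ : (1 - β (ξ - 1)) * (d1 N y ξ - d1 N y (ξ - 1)) ^ 2 = eps N ^ 2 * |f₃ (ξ - 1)| := by
      rw [abs_of_nonneg (mul_nonneg ht (sq_nonneg _))]
      simp only [d2_eq hN0, sub_add_cancel]
      field_simp
    rw [e₁, e₂, e₃, e₄, abs_neg, abs_mul (eps N), abs_mul (eps N ^ 2), abs_of_pos hε, abs_of_pos (pow_pos hε 2)]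
    ring
  rw [fvar_PhiAt_sub_fvar_PhiBQNL hdiff hηper haper (fun ξ => hy'.trans_le (ham ξ)) hvper, abs_mul,
    abs_of_pos hε]
  calc _ ≤ eps N * ∑ ξ ∈ Finset.Icc (1 : ℤ) N,
          (eps N * C₂ * |f₁ ξ| + eps N ^ 2 * C₂ * |f₂ ξ| + eps N ^ 2 * (C₃ / 2) * |f₃ ξ|
            + eps N ^ 2 * (C₃ / 2) * |f₃ (ξ - 1)|) * |d1 N u ξ| := by
        gcongr
        refine (Finset.abs_sum_le_sum_abs _ _).trans (Finset.sum_le_sum fun ξ _ => ?_)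
        rw [abs_mul]
        exact mul_le_mul_of_nonneg_right (hstress ξ) (abs_nonneg _)
    _ = eps N * C₂ * (eps N * ∑ ξ ∈ Finset.Icc (1 : ℤ) N, |f₁ ξ| * |d1 N u ξ|)
          + eps N ^ 2 * C₂ * (eps N * ∑ ξ ∈ Finset.Icc (1 : ℤ) N, |f₂ ξ| * |d1 N u ξ|)
          + eps N ^ 2 * (C₃ / 2) * (eps N * ∑ ξ ∈ Finset.Icc (1 : ℤ) N, |f₃ ξ| * |d1 N u ξ|)
          + eps N ^ 2 * (C₃ / 2)
            * (eps N * ∑ ξ ∈ Finset.Icc (1 : ℤ) N, |f₃ (ξ - 1)| * |d1 N u ξ|) := by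
        simp only [Finset.mul_sum, ← Finset.sum_add_distrib]
        refine Finset.sum_congr rfl fun ξ _ => ?_
        ring
    _ ≤ eps N * C₂ * lpnorm N p f₁ + eps N ^ 2 * C₂ * lpnorm N p f₂
          + eps N ^ 2 * (C₃ / 2) * lpnorm N p f₃ + eps N ^ 2 * (C₃ / 2) * lpnorm N p f₃ := by
        gcongr
        · exact holder hf₁per
        · exact holder hf₂per
        · exact holder hf₃per
    _ = _ := by ring
end

section
/- (Ghost force of BQCE under uniform strain.) For every F > 0, every N-periodic blending function γ : ℤ → [0,1], and every u ∈ 𝒰, the first variation of the BQCE energy at the uniform deformation is δΦ^bqce_γ(y^F)[u] = −ε φ'(2F) Σ_{ξ=1}^N Δ²α_ξ u'_ξ, where α_ξ := (γ_ξ + γ_{ξ−1})/2. -/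
open scoped BigOperators ENNReal
open Finset

lemma sum_Icc_int_forward_diff (f : ℤ → ℝ) (n : ℕ) :
    ∑ ξ ∈ Finset.Icc (1 : ℤ) (n : ℤ), (f (ξ + 1) - f ξ) = f (n + 1) - f 1 := by
  induction n with
  | zero => simp
  | succ k ih =>
    have h : Finset.Icc (1 : ℤ) ((k + 1 : ℕ) : ℤ)
        = insert ((k : ℤ) + 1) (Finset.Icc (1 : ℤ) (k : ℤ)) := by
      ext x
      simp only [Finset.mem_Icc, Finset.mem_insert]
      omega
    rw [h, Finset.sum_insert (by simp), ih]
    push_cast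
    ring

lemma IsPeriodic.sum_forward_diff_eq_zero {N : ℕ} {f : ℤ → ℝ} (hf : IsPeriodic N f) :
    ∑ ξ ∈ Finset.Icc (1 : ℤ) (N : ℤ), (f (ξ + 1) - f ξ) = 0 := by
  rw [sum_Icc_int_forward_diff, add_comm, hf, sub_self]

lemma IsPeriodic.sub_one {N : ℕ} {f : ℤ → ℝ} (hf : IsPeriodic N f) :
    IsPeriodic N (fun ξ => f (ξ - 1)) := fun ξ => by
  simpa [add_sub_right_comm] using hf (ξ - 1)

lemma d1_yUnif_add_mul {N : ℕ} (hN : N ≠ 0) (F t : ℝ) (u : ℤ → ℝ) (ξ : ℤ) :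
    d1 N (fun ζ => yUnif N F ζ + t * u ζ) ξ = F + t * d1 N u ξ := by
  have h : eps N ≠ 0 := inv_ne_zero (Nat.cast_ne_zero.mpr hN)
  simp only [d1, yUnif]
  push_cast
  field_simp
  ring

/-- The first variation of the BQC energy at a uniform deformation. -/
lemma fvar_PhiBQC_yUnif {N : ℕ} (hN : N ≠ 0) {φ : ℝ → ℝ} {F : ℝ}
    (hφF : DifferentiableAt ℝ φ F) (hφ2F : DifferentiableAt ℝ φ (2 * F)) (α β u : ℤ → ℝ) :
    fvar (PhiBQC N φ α β) (yUnif N F) u =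
      eps N * ∑ ξ ∈ Finset.Icc (1 : ℤ) (N : ℤ),
        (deriv φ F * d1 N u ξ + α ξ * (deriv φ (2 * F) * (2 * d1 N u ξ)) +
          β ξ * (deriv φ (2 * F) * (d1 N u ξ + d1 N u (ξ + 1)))) := by
  have affine (a b : ℝ) (h : DifferentiableAt ℝ φ a) :
      HasDerivAt (fun t : ℝ => φ (a + t * b)) (deriv φ a * b) 0 := by
    have hline : HasDerivAt (fun t : ℝ => a + t * b) b 0 := by
      simpa using ((hasDerivAt_id (0 : ℝ)).mul_const b).const_add a
    exact HasDerivAt.comp (h₂ := φ) 0 (by simpa using h.hasDerivAt) hline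
  refine HasDerivAt.deriv ?_
  simp only [PhiBQC, d1_yUnif_add_mul hN]
  refine (HasDerivAt.fun_sum fun ξ _ => ?_).const_mul (eps N)
  have h₂ := (affine (2 * F) (2 * d1 N u ξ) hφ2F).const_mul (α ξ)
  have h₃ := (affine (2 * F) (d1 N u ξ + d1 N u (ξ + 1)) hφ2F).const_mul (β ξ)
  convert ((affine F (d1 N u ξ) hφF).add h₂).add h₃ using 1
  funext t
  simp only [Pi.add_apply]
  ring_nf

/-- Ghost force of BQCE under uniform strain. -/
theorem bqce_ghost_force_uniform_strain
    (N : ℕ) (hN : 5 ≤ N) (φ : ℝ → ℝ) (hφ : ContDiffOn ℝ 4 φ (Set.Ioi 0))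
    (F : ℝ) (hF : 0 < F)
    (γ : ℤ → ℝ) (hγper : IsPeriodic N γ) (hγ01 : ∀ ξ, γ ξ ∈ Set.Icc (0 : ℝ) 1)
    (α : ℤ → ℝ) (hα : α = fun ξ => (γ ξ + γ (ξ - 1)) / 2)
    (u : ℤ → ℝ) (hu : inU N u) :
    fvar (PhiBQCE N φ γ) (yUnif N F) u =
      -(eps N) * deriv φ (2 * F) *
        ∑ ξ ∈ Finset.Icc (1 : ℤ) (N : ℤ),
          (α (ξ + 1) - 2 * α ξ + α (ξ - 1)) * d1 N u ξ := by
  have hN0 : N ≠ 0 := by omega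
  have hdiff (r : ℝ) (hr : 0 < r) : DifferentiableAt ℝ φ r :=
    (hφ.differentiableOn (by norm_num)).differentiableAt (Ioi_mem_nhds hr)
  have hw : IsPeriodic N (d1 N u) := fun ξ => by
    have h : u (ξ + N - 1) = u (ξ - 1) := hu.1.sub_one ξ
    simp only [d1]
    rw [hu.1 ξ, h]
  have hβw : IsPeriodic N (fun ξ => (1 - (γ ξ + γ (ξ - 1 - 1)) / 2) * d1 N u ξ) := fun ξ => by
    have h : γ (ξ + N - 1 - 1) = γ (ξ - 1 - 1) := hγper.sub_one.sub_one ξ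
    simp only
    rw [hγper ξ, h, hw ξ]
  have hu_sum := hu.1.sub_one.sum_forward_diff_eq_zero
  have hβw_sum := hβw.sum_forward_diff_eq_zero
  rw [PhiBQCE, fvar_PhiBQC_yUnif hN0 (hdiff F hF) (hdiff _ (by positivity)), mul_assoc,
    neg_mul, ← mul_neg]
  congr 1
  rw [← sub_eq_zero, sub_neg_eq_add, Finset.mul_sum, ← Finset.sum_add_distrib]
  calc _ = ∑ ξ ∈ Finset.Icc (1 : ℤ) (N : ℤ),
        ((deriv φ F + 2 * deriv φ (2 * F)) / eps N * (u (ξ + 1 - 1) - u (ξ - 1)) +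
          deriv φ (2 * F) * ((1 - (γ (ξ + 1) + γ (ξ + 1 - 1 - 1)) / 2) * d1 N u (ξ + 1) -
            (1 - (γ ξ + γ (ξ - 1 - 1)) / 2) * d1 N u ξ)) := by
        refine Finset.sum_congr rfl fun ξ _ => ?_
        have hd : d1 N u ξ = (u ξ - u (ξ - 1)) / eps N := rfl
        simp only [hα, add_sub_cancel_right]
        rw [hd]
        ring
    _ = 0 := by
        rw [Finset.sum_add_distrib, ← Finset.mul_sum, ← Finset.mul_sum, hu_sum, hβw_sum]
        simp
end
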